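/- Let n ≥ 2, U ⊆ ℝ^{n−1} open, X : U → ℝⁿ a C^∞ immersion with C^∞ unit normal field 𝐧 : U → ℝⁿ, and define D : U×ℝⁿ → ℝ by D(u,v) = ‖X(u) − v‖² and Δ*D : U×ℝⁿ → ℝ×ℝ^{n−1} by Δ*D(u,v) = (D(u,v), (∂D/∂u₁)(u,v), …, (∂D/∂u_{n−1})(u,v)). Then at every point (u,v) ∈ U×ℝⁿ such that v = X(u) + r·𝐧(u) for some r ≠ 0, the total derivative of Δ*D is surjective; in particular, at every such point the total derivative of ΔD = ((∂D/∂u₁), …, (∂D/∂u_{n−1})) : U×ℝⁿ → ℝ^{n−1} is also surjective. -/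

import Mathlib

open RealInnerProductSpace

/-- The partial derivative of `(x, y) ↦ ‖X x - y‖ ^ 2` in the first variable. -/
theorem fderiv_norm_sub_sq_apply {E F : Type*} [NormedAddCommGroup E] [NormedSpace ℝ E]
    [NormedAddCommGroup F] [InnerProductSpace ℝ F] {X : E → F} {u : E}
    (hX : DifferentiableAt ℝ X u) (v : F) (e : E) :
    fderiv ℝ (fun w : E × F => ‖X w.1 - w.2‖ ^ 2) (u, v) (e, 0) =
      2 * ⟪X u - v, fderiv ℝ X u e⟫ := by
  have h1 : HasFDerivAt (fun w : E × F => X w.1 - w.2)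
      ((fderiv ℝ X u).comp (ContinuousLinearMap.fst ℝ E F) - ContinuousLinearMap.snd ℝ E F)
      (u, v) :=
    (HasFDerivAt.comp (u, v) (f := Prod.fst) hX.hasFDerivAt hasFDerivAt_fst).sub hasFDerivAt_snd
  rw [h1.norm_sq.fderiv]
  simp [inner_sub_left]

/-- Given an injective linear map and a unit vector orthogonal to its range, the inner products of a
vector with this unit vector and with the images of the standard basis can be prescribed. -/
theorem exists_inner_eq_of_injective {ι F : Type*} [Fintype ι] [DecidableEq ι]
    [NormedAddCommGroup F] [InnerProductSpace ℝ F] [FiniteDimensional ℝ F]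
    (A : EuclideanSpace ℝ ι →L[ℝ] F) (hA : Function.Injective A) {ν : F} (hν : ‖ν‖ = 1)
    (hperp : ∀ w, ⟪ν, A w⟫ = 0) (s : ℝ) (c : ι → ℝ) :
    ∃ b : F, ⟪ν, b⟫ = s ∧ ∀ i, ⟪b, A (EuclideanSpace.single i 1)⟫ = c i := by
  obtain ⟨L, hL⟩ := LinearMap.exists_leftInverse_of_injective (A : EuclideanSpace ℝ ι →ₗ[ℝ] F)
    (LinearMap.ker_eq_bot.2 hA)
  set b₀ := LinearMap.adjoint L (WithLp.toLp 2 c)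
  refine ⟨b₀ + (s - ⟪ν, b₀⟫) • ν, ?_, fun i => ?_⟩
  · rw [inner_add_right, real_inner_smul_right, real_inner_self_eq_norm_sq, hν]
    ring
  · have h := LinearMap.congr_fun hL (EuclideanSpace.single i 1)
    simp only [LinearMap.comp_apply, ContinuousLinearMap.coe_coe, LinearMap.id_apply] at h
    rw [inner_add_left, real_inner_smul_left, hperp, LinearMap.adjoint_inner_left, h]
    simp [EuclideanSpace.inner_single_right]

/-- Proposition 5.7: the distance squared function `D(u,v) = ‖X(u) − v‖²` of a
hypersurface `X : U → ℝⁿ` with unit normal `𝐧` has surjective derivative of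
`Δ*D = (D, ∂D/∂u₁, …, ∂D/∂u_{n−1})` at every point `(u, v)` with
`v = X(u) + r·𝐧(u)`, `r ≠ 0`; in particular the derivative of
`ΔD = (∂D/∂u₁, …, ∂D/∂u_{n−1})` is also surjective there (so `D` is a Morse family
of functions and `D̄ = D − t` a non-degenerate graph-like Morse family). -/
theorem stmt_12 {n : ℕ} (hn : 2 ≤ n)
    (U : Set (EuclideanSpace ℝ (Fin (n - 1)))) (hU : IsOpen U)
    (X nor : EuclideanSpace ℝ (Fin (n - 1)) → EuclideanSpace ℝ (Fin n))
    (hX : ContDiffOn ℝ (⊤ : ℕ∞) X U)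
    (himm : ∀ u ∈ U, Function.Injective ⇑(fderiv ℝ X u))
    (hnor : ContDiffOn ℝ (⊤ : ℕ∞) nor U)
    (hunit : ∀ u ∈ U, ‖nor u‖ = 1)
    (hperp : ∀ u ∈ U, ∀ w, ⟪nor u, fderiv ℝ X u w⟫ = 0)
    (D : EuclideanSpace ℝ (Fin (n - 1)) × EuclideanSpace ℝ (Fin n) → ℝ)
    (hD : ∀ w, D w = ‖X w.1 - w.2‖ ^ 2) :
    ∀ u ∈ U, ∀ (r : ℝ), r ≠ 0 → ∀ v : EuclideanSpace ℝ (Fin n),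
      v = X u + r • nor u →
      Function.Surjective ⇑(fderiv ℝ
        (fun w : EuclideanSpace ℝ (Fin (n - 1)) × EuclideanSpace ℝ (Fin n) =>
          ((D w, fun i : Fin (n - 1) =>
              fderiv ℝ D w (EuclideanSpace.single i 1, 0)) : ℝ × (Fin (n - 1) → ℝ)))
        (u, v)) ∧
      Function.Surjective ⇑(fderiv ℝ
        (fun w : EuclideanSpace ℝ (Fin (n - 1)) × EuclideanSpace ℝ (Fin n) =>
          (fun i : Fin (n - 1) =>
              fderiv ℝ D w (EuclideanSpace.single i 1, 0) : Fin (n - 1) → ℝ))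
        (u, v)) := by
  intro u hu r hr v hv
  obtain rfl : D = fun w => ‖X w.1 - w.2‖ ^ 2 := funext hD
  have hXu : ContDiffAt ℝ (⊤ : ℕ∞) X u := hX.contDiffAt (hU.mem_nhds hu)
  have hXd : DifferentiableAt ℝ X u := hXu.differentiableAt (by simp)
  set D : EuclideanSpace ℝ (Fin (n - 1)) × EuclideanSpace ℝ (Fin n) → ℝ :=
    fun w => ‖X w.1 - w.2‖ ^ 2
  have hDs : ContDiffAt ℝ (⊤ : ℕ∞) D (u, v) :=
    ((ContDiffAt.comp (u, v) (f := Prod.fst) hXu contDiffAt_fst).sub contDiffAt_snd).norm_sq ℝ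
  have hDd : DifferentiableAt ℝ (fderiv ℝ D) (u, v) :=
    (hDs.fderiv_right (m := 1) (by norm_cast)).differentiableAt (by simp)
  have hG : DifferentiableAt ℝ (fun w => fun i : Fin (n - 1) =>
      fderiv ℝ D w (EuclideanSpace.single i 1, 0)) (u, v) :=
    differentiableAt_pi.2 fun i => hDd.clm_apply (differentiableAt_const _)
  have hD1 : DifferentiableAt ℝ D (u, v) := hDs.differentiableAt (by simp)
  have key : Function.Surjective (fderiv ℝ (fun w => ((D w, fun i : Fin (n - 1) =>
      fderiv ℝ D w (EuclideanSpace.single i 1, 0)) : ℝ × (Fin (n - 1) → ℝ))) (u, v)) := by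
    rintro ⟨a, c⟩
    obtain ⟨b, hb, hbc⟩ := exists_inner_eq_of_injective (fderiv ℝ X u) (himm u hu) (hunit u hu)
      (hperp u hu) (a / (2 * r)) (fun i => -c i / 2)
    refine ⟨(0, b), ?_⟩
    have hline : HasDerivAt (fun t : ℝ => ((u, v + t • b) :
        EuclideanSpace ℝ (Fin (n - 1)) × EuclideanSpace ℝ (Fin n))) (0, b) 0 := by
      have h := ((hasDerivAt_id (0 : ℝ)).smul_const b).const_add v
      rw [one_smul] at h
      exact (hasDerivAt_const (0 : ℝ) u).prodMk h
    rw [hD1.fderiv_prodMk hG]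
    refine Prod.ext ?_ (funext fun i => ?_)
    · have h : HasFDerivAt D (fderiv ℝ D (u, v)) (u, v + (0 : ℝ) • b) := by
        simpa using hD1.hasFDerivAt
      have h1 := h.comp_hasDerivAt (0 : ℝ) hline
      have h2 : HasDerivAt (fun t : ℝ => ‖X u - (v + t • b)‖ ^ 2) (2 * ⟪X u - v, -b⟫) 0 := by
        have h := (((hasDerivAt_id (0 : ℝ)).smul_const b).const_add v).const_sub (X u)
        simpa using h.norm_sq
      refine (h1.unique h2).trans ?_
      have : X u - v = -(r • nor u) := by rw [hv]; abel
      rw [this, inner_neg_neg, real_inner_smul_left, hb]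
      field_simp
    · rw [ContinuousLinearMap.prod_apply]
      have h : HasFDerivAt (fun w => fun i : Fin (n - 1) =>
          fderiv ℝ D w (EuclideanSpace.single i 1, 0)) (fderiv ℝ (fun w => fun i : Fin (n - 1) =>
          fderiv ℝ D w (EuclideanSpace.single i 1, 0)) (u, v)) (u, v + (0 : ℝ) • b) := by
        simpa using hG.hasFDerivAt
      have h1 := hasDerivAt_pi.1 (h.comp_hasDerivAt (0 : ℝ) hline) i
      have h2 : HasDerivAt (fun t : ℝ => 2 * ⟪X u - (v + t • b),
          fderiv ℝ X u (EuclideanSpace.single i 1)⟫) (c i) 0 := by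
        have h := (((((hasDerivAt_id (0 : ℝ)).smul_const b).const_add v).const_sub (X u)).inner ℝ
          (hasDerivAt_const (0 : ℝ) (fderiv ℝ X u (EuclideanSpace.single i 1)))).const_mul 2
        refine h.congr_deriv ?_
        simp only [inner_zero_right, one_smul, inner_neg_left, hbc]
        ring
      refine h1.unique (h2.congr_of_eventuallyEq (Filter.Eventually.of_forall fun t => ?_))
      exact fderiv_norm_sub_sq_apply hXd _ _
  refine ⟨key, fun c => ?_⟩
  obtain ⟨w, hw⟩ := key (0, c)
  rw [hD1.fderiv_prodMk hG, ContinuousLinearMap.prod_apply] at hw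
  exact ⟨w, (Prod.mk.inj hw).2⟩
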